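/- arXiv:2211.11475 — 9 statements merged into one kernel-verified Lean document; each statement's English description precedes it below -/
import Mathlib

section
/- The function f(z) = √z · (1 + e^{−z}) is strictly increasing on the interval (0, ∞). -/
theorem two_mul_lt_exp_add_one {z : ℝ} (hz : 0 < z) : 2 * z < Real.exp z + 1 := by
  have h := Real.quadratic_le_exp_of_nonneg hz.le
  nlinarith [sq_nonneg (z - 1)]

/-- The function `f(z) = √z · (1 + e^{−z})` is strictly increasing on `(0, ∞)`. -/
theorem stmt2 : StrictMonoOn (fun z : ℝ => Real.sqrt z * (1 + Real.exp (-z))) (Set.Ioi 0) := by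
  refine strictMonoOn_of_deriv_pos (convex_Ioi 0) (by fun_prop) fun z hz => ?_
  rw [interior_Ioi, Set.mem_Ioi] at hz
  have hderiv := (Real.hasDerivAt_sqrt hz.ne').mul ((hasDerivAt_neg z).exp.const_add 1)
  have hsqrt : 0 < √z := Real.sqrt_pos.mpr hz
  have hsq : √z * √z = z := Real.mul_self_sqrt hz.le
  have hexp : Real.exp z * Real.exp (-z) = 1 := by rw [← Real.exp_add]; simp
  have hpos : 0 < (Real.exp z + 1 - 2 * z) * Real.exp (-z) :=
    mul_pos (sub_pos.mpr (two_mul_lt_exp_add_one hz)) (Real.exp_pos _)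
  refine lt_of_lt_of_eq (div_pos hpos (mul_pos two_pos hsqrt)) (Eq.trans ?_ hderiv.deriv.symm)
  field_simp
  linear_combination hexp + 2 * Real.exp (-z) * hsq
end

section
/- Fix x ∈ (0, π). Then the map y ↦ h̃(x, y) is strictly decreasing on (0, ∞), where h̃(x, y) = (1/√(2π · y · sin²x)) · (1 + exp(−2(π − x)²/y)). -/
/-- The paper's approximation `h̃(x, y)` of the expected beamforming-gain factor. -/
noncomputable def htilde (x y : ℝ) : ℝ :=
  (1 / Real.sqrt (2 * Real.pi * y * (Real.sin x) ^ 2)) *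
    (1 + Real.exp (-2 * (Real.pi - x) ^ 2 / y))

/-- The map `u ↦ u (1 + exp (-c u²))` is strictly increasing when `c ≥ 0`. -/
theorem strictMono_mul_one_add_exp_neg_mul_sq {c : ℝ} (hc : 0 ≤ c) :
    StrictMono (fun u : ℝ => u * (1 + Real.exp (-(c * u ^ 2)))) := by
  refine strictMono_of_hasDerivAt_pos
    (f' := fun u => 1 + Real.exp (-(c * u ^ 2)) * (1 - 2 * (c * u ^ 2))) (fun u => ?_) fun u => ?_
  · have h := (hasDerivAt_id u).mul
      ((((hasDerivAt_pow 2 u).const_mul c).neg.exp).const_add 1)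
    refine h.congr_deriv ?_
    simp only [id_eq, Pi.neg_apply]
    push_cast
    ring
  · have hs : 0 ≤ c * u ^ 2 := by positivity
    generalize c * u ^ 2 = s at hs
    have hquad := Real.quadratic_le_exp_of_nonneg hs
    have hlt : 2 * s - 1 < Real.exp s := by nlinarith [sq_nonneg (s - 1)]
    have hmul : Real.exp (-s) * Real.exp s = 1 := by rw [← Real.exp_add]; simp
    nlinarith [mul_lt_mul_of_pos_left hlt (Real.exp_pos (-s))]

/-- `htilde x y` in terms of `u = (√y)⁻¹`. -/
theorem htilde_eq_mul_inv_sqrt (x : ℝ) {y : ℝ} (hy : 0 < y) :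
    htilde x y = (Real.sqrt (2 * Real.pi * Real.sin x ^ 2))⁻¹ *
      ((Real.sqrt y)⁻¹ *
        (1 + Real.exp (-(2 * (Real.pi - x) ^ 2 * ((Real.sqrt y)⁻¹) ^ 2)))) := by
  have hexp : -2 * (Real.pi - x) ^ 2 / y =
      -(2 * (Real.pi - x) ^ 2 * ((Real.sqrt y)⁻¹) ^ 2) := by
    rw [inv_pow, Real.sq_sqrt hy.le]
    ring
  have hsqrt : Real.sqrt (2 * Real.pi * y * Real.sin x ^ 2) =
      Real.sqrt (2 * Real.pi * Real.sin x ^ 2) * Real.sqrt y := by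
    rw [← Real.sqrt_mul (by positivity)]
    ring_nf
  rw [htilde, hexp, hsqrt, one_div, mul_inv, mul_assoc]

/-- For fixed `x ∈ (0, π)`, the map `y ↦ h̃(x, y)` is strictly decreasing on `(0, ∞)`. -/
theorem stmt4 (x : ℝ) (hx : x ∈ Set.Ioo 0 Real.pi) :
    StrictAntiOn (fun y => htilde x y) (Set.Ioi 0) := by
  intro a ha b hb hab
  have ha : 0 < a := ha
  have hb : 0 < b := hb
  have hsin : 0 < Real.sin x := Real.sin_pos_of_mem_Ioo hx
  have hinv : (Real.sqrt b)⁻¹ < (Real.sqrt a)⁻¹ :=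
    inv_strictAnti₀ (Real.sqrt_pos.2 ha) (Real.sqrt_lt_sqrt ha.le hab)
  simp only [htilde_eq_mul_inv_sqrt x ha, htilde_eq_mul_inv_sqrt x hb]
  exact mul_lt_mul_of_pos_left
    (strictMono_mul_one_add_exp_neg_mul_sq (c := 2 * (Real.pi - x) ^ 2) (by positivity) hinv)
    (by positivity)
end

section
/- Fix angles φ, ϕ ∈ (0, π) and positive constants σ_φ², σ_ϕ², A_φ, A_ϕ, C. For t ≥ 0 define the tracked-angle variances σ̃_φ²(t) = σ_φ²·A_φ/(σ_φ²·t + A_φ) and σ̃_ϕ²(t) = σ_ϕ²·A_ϕ/(σ_ϕ²·t + A_ϕ), and the communication-only-stage rate R̃^C(t) = log₂(1 + C · h̃(φ, σ̃_φ²(t)) · h̃(ϕ, σ̃_ϕ²(t))). Then R̃^C is strictly increasing on [0, ∞). -/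
lemma strictMono_mul_one_add_exp_neg_sq :
    StrictMono (fun u : ℝ => u * (1 + Real.exp (-u)) ^ 2) := by
  apply strictMono_of_deriv_pos
  intro u
  have hexp : HasDerivAt (fun u : ℝ => 1 + Real.exp (-u)) (-Real.exp (-u)) u := by
    simpa using ((hasDerivAt_neg u).exp).const_add 1
  have h := (hasDerivAt_id' u).fun_mul (hexp.fun_pow 2)
  rw [h.deriv]
  have hpos : 0 < Real.exp (-u) := Real.exp_pos _
  have hkey : 0 < 1 + Real.exp (-u) - 2 * u * Real.exp (-u) := by
    have h2u : 2 * u ≤ Real.exp u := by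
      have h1 := Real.add_one_le_exp (u - 1)
      have h2 : Real.exp u = Real.exp (u - 1) * Real.exp 1 := by
        rw [← Real.exp_add]; congr 1; ring
      have h3 := Real.add_one_le_exp (1 : ℝ)
      nlinarith [Real.exp_pos (u - 1)]
    have hmul : Real.exp u * Real.exp (-u) = 1 := by
      rw [← Real.exp_add]; simp
    nlinarith
  have : 0 < (1 + Real.exp (-u)) * (1 + Real.exp (-u) - 2 * u * Real.exp (-u)) := by
    positivity
  norm_num
  nlinarith

lemma htilde_pos {x y : ℝ} (hx : x ∈ Set.Ioo 0 Real.pi) (hy : 0 < y) : 0 < htilde x y := by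
  have hs : 0 < Real.sin x := Real.sin_pos_of_mem_Ioo hx
  unfold htilde
  positivity

lemma htilde_sq {x y : ℝ} (hx : x ∈ Set.Ioo 0 Real.pi) (hy : 0 < y) :
    htilde x y ^ 2 = (4 * Real.pi * Real.sin x ^ 2 * (Real.pi - x) ^ 2)⁻¹ *
      (2 * (Real.pi - x) ^ 2 / y * (1 + Real.exp (-(2 * (Real.pi - x) ^ 2 / y))) ^ 2) := by
  have hs : 0 < Real.sin x := Real.sin_pos_of_mem_Ioo hx
  have hd : 0 < Real.pi - x := sub_pos.2 hx.2
  unfold htilde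
  rw [mul_pow, div_pow, Real.sq_sqrt (by positivity), neg_mul, neg_div]
  field_simp
  norm_num

lemma htilde_strictAntiOn {x : ℝ} (hx : x ∈ Set.Ioo 0 Real.pi) :
    StrictAntiOn (htilde x) (Set.Ioi 0) := by
  intro a ha b hb hab
  have ha : 0 < a := ha
  have hb : 0 < b := hb
  have hs : 0 < Real.sin x := Real.sin_pos_of_mem_Ioo hx
  have hd : 0 < Real.pi - x := sub_pos.2 hx.2
  apply lt_of_pow_lt_pow_left₀ 2 (htilde_pos hx ha).le
  rw [htilde_sq hx ha, htilde_sq hx hb]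
  apply mul_lt_mul_of_pos_left _ (by positivity)
  apply strictMono_mul_one_add_exp_neg_sq
  exact div_lt_div_of_pos_left (by positivity) ha hab

lemma htilde_comp_variance_strictMonoOn {x s A : ℝ} (hx : x ∈ Set.Ioo 0 Real.pi)
    (hs : 0 < s) (hA : 0 < A) :
    StrictMonoOn (fun t => htilde x (s * A / (s * t + A))) (Set.Ici 0) := by
  intro a ha b hb hab
  have ha : 0 ≤ a := ha
  have hb : 0 ≤ b := hb
  apply htilde_strictAntiOn hx
  · exact Set.mem_Ioi.2 (by positivity)
  · exact Set.mem_Ioi.2 (by positivity)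
  · exact div_lt_div_of_pos_left (by positivity) (by positivity) (by gcongr)

/-- Lemma 3: the communication-only-stage rate `R̃^C(t)` is strictly increasing in the
sensing resource `t = η·β^R`. -/
theorem stmt5 (φ ϕ : ℝ) (hφ : φ ∈ Set.Ioo 0 Real.pi) (hϕ : ϕ ∈ Set.Ioo 0 Real.pi)
    (σφ2 σϕ2 Aφ Aϕ C : ℝ) (hσφ : 0 < σφ2) (hσϕ : 0 < σϕ2)
    (hAφ : 0 < Aφ) (hAϕ : 0 < Aϕ) (hC : 0 < C) :
    StrictMonoOn (fun t =>
      Real.logb 2 (1 + C * htilde φ (σφ2 * Aφ / (σφ2 * t + Aφ))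
        * htilde ϕ (σϕ2 * Aϕ / (σϕ2 * t + Aϕ)))) (Set.Ici 0) := by
  intro a ha b hb hab
  have h1 := htilde_comp_variance_strictMonoOn hφ hσφ hAφ ha hb hab
  have h2 := htilde_comp_variance_strictMonoOn hϕ hσϕ hAϕ ha hb hab
  have ha : 0 ≤ a := ha
  have p1 : 0 < htilde φ (σφ2 * Aφ / (σφ2 * a + Aφ)) := htilde_pos hφ (by positivity)
  have p2 : 0 < htilde ϕ (σϕ2 * Aϕ / (σϕ2 * a + Aϕ)) := htilde_pos hϕ (by positivity)
  apply Real.logb_lt_logb one_lt_two (by positivity)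
  rw [mul_assoc, mul_assoc]
  gcongr 1 + C * ?_
  exact mul_lt_mul'' h1 h2 p1.le p2.le
end

section
/- Let C₁ > 0, D₂ > 0, D₃ > 0, set D₁ = C₁/√(D₂·D₃), and define R̂(η, β) = η·log₂(1 + C₁(1 − β)) + (1 − η)·log₂(1 + D₁·√((ηβ + D₂)(ηβ + D₃))) for (η, β) ∈ [0,1]×[0,1]. Then there exist η ∈ (0, 1] and β ∈ [0, 1] with R̂(η, β) > log₂(1 + C₁) if and only if 1/D₂ + 1/D₃ > 2. Equivalently, since R̂(0, β) = log₂(1 + C₁) for every β, the maximum of R̂ over [0,1]² is attained only with η > 0 if and only if 1/D₂ + 1/D₃ > 2. -/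
/-- The approximate achievable rate `R̂(η, β)` of problem (P3). -/
noncomputable def Rhat (C₁ D₁ D₂ D₃ η β : ℝ) : ℝ :=
  η * Real.logb 2 (1 + C₁ * (1 - β)) +
    (1 - η) * Real.logb 2 (1 + D₁ * Real.sqrt ((η * β + D₂) * (η * β + D₃)))

open Filter Topology

theorem Real.log_le_log_add_sub_div {x y : ℝ} (hx : 0 < x) (hy : 0 < y) :
    Real.log y ≤ Real.log x + (y - x) / x := by
  have h := Real.log_le_sub_one_of_pos (div_pos hy hx)
  rw [Real.log_div hy.ne' hx.ne'] at h
  have h' : (y - x) / x = y / x - 1 := by field_simp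
  linarith

theorem HasDerivAt.exists_mem_Ioc_lt {f : ℝ → ℝ} {f' a b : ℝ} (h : HasDerivAt f f' a)
    (hf' : 0 < f') (hab : a < b) : ∃ x ∈ Set.Ioc a b, f a < f x := by
  have hs : ∀ᶠ x in 𝓝[>] a, 0 < slope f a x :=
    (h.tendsto_slope.mono_left (nhdsGT_le_nhdsNE a)).eventually (lt_mem_nhds hf')
  obtain ⟨x, hx, hmem⟩ := (hs.and (Ioc_mem_nhdsGT hab)).exists
  refine ⟨x, hmem, ?_⟩
  rw [slope_def_field, div_pos_iff_of_pos_right (sub_pos.2 hmem.1)] at hx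
  exact sub_pos.1 hx

theorem Rhat_eq_log_div (C₁ D₁ D₂ D₃ η β : ℝ) :
    Rhat C₁ D₁ D₂ D₃ η β =
      (η * Real.log (1 + C₁ * (1 - β)) +
        (1 - η) * Real.log (1 + D₁ * Real.sqrt ((η * β + D₂) * (η * β + D₃)))) / Real.log 2 := by
  simp only [Rhat, Real.logb]
  ring

theorem Rhat_eq_of_eq_zero_or_eq_zero {C₁ D₂ D₃ η β : ℝ} (hD₂ : 0 < D₂) (hD₃ : 0 < D₃)
    (h : η = 0 ∨ β = 0) :
    Rhat C₁ (C₁ / Real.sqrt (D₂ * D₃)) D₂ D₃ η β = Real.logb 2 (1 + C₁) := by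
  have hS : Real.sqrt (D₂ * D₃) ≠ 0 := (Real.sqrt_pos.2 (mul_pos hD₂ hD₃)).ne'
  rcases h with rfl | rfl
  · simp [Rhat, div_mul_cancel₀ _ hS]
  · simp only [Rhat, mul_zero, zero_add, sub_zero, mul_one, div_mul_cancel₀ _ hS]
    ring

theorem sqrt_add_mul_add_le {D₂ D₃ t : ℝ} (hD₂ : 0 < D₂) (hD₃ : 0 < D₃) (ht : 0 ≤ t)
    (h : 1 / D₂ + 1 / D₃ ≤ 2) :
    Real.sqrt ((t + D₂) * (t + D₃)) ≤ Real.sqrt (D₂ * D₃) * (1 + t) := by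
  have hsum : D₂ + D₃ ≤ 2 * (D₂ * D₃) := by
    rw [div_add_div _ _ hD₂.ne' hD₃.ne', div_le_iff₀ (mul_pos hD₂ hD₃)] at h
    linarith
  have hprod : 1 ≤ D₂ * D₃ := by nlinarith [sq_nonneg (D₂ - D₃), mul_pos hD₂ hD₃]
  rw [Real.sqrt_le_left (by positivity), mul_pow, Real.sq_sqrt (by positivity)]
  nlinarith [mul_le_mul_of_nonneg_left hsum ht, mul_le_mul_of_nonneg_left hprod (sq_nonneg t)]

theorem Rhat_le {C₁ D₂ D₃ η β : ℝ} (hC : 0 < C₁) (hD₂ : 0 < D₂) (hD₃ : 0 < D₃)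
    (hη : η ∈ Set.Icc (0 : ℝ) 1) (hβ : β ∈ Set.Icc (0 : ℝ) 1) (h : 1 / D₂ + 1 / D₃ ≤ 2) :
    Rhat C₁ (C₁ / Real.sqrt (D₂ * D₃)) D₂ D₃ η β ≤ Real.logb 2 (1 + C₁) := by
  obtain ⟨hη₀, hη₁⟩ := hη
  obtain ⟨hβ₀, hβ₁⟩ := hβ
  have hS : 0 < Real.sqrt (D₂ * D₃) := Real.sqrt_pos.2 (mul_pos hD₂ hD₃)
  have ht : 0 ≤ η * β := mul_nonneg hη₀ hβ₀
  have hC' : 0 < 1 + C₁ := by linarith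
  have hsnr : C₁ / Real.sqrt (D₂ * D₃) * Real.sqrt ((η * β + D₂) * (η * β + D₃)) ≤
      C₁ * (1 + η * β) := by
    rw [div_mul_eq_mul_div, div_le_iff₀ hS]
    nlinarith [mul_le_mul_of_nonneg_left (sqrt_add_mul_add_le hD₂ hD₃ ht h) hC.le]
  have hcomm := Real.log_le_log_add_sub_div hC'
    (show 0 < 1 + C₁ * (1 - β) by nlinarith [mul_nonneg hC.le (sub_nonneg.2 hβ₁)])
  have hsense := (Real.log_le_log (by positivity) (add_le_add_right hsnr 1)).trans
    (Real.log_le_log_add_sub_div hC' (by positivity))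
  rw [Rhat_eq_log_div, Real.logb]
  refine div_le_div_of_nonneg_right ?_ (Real.log_nonneg one_le_two)
  have hloss : η * ((1 + C₁ * (1 - β) - (1 + C₁)) / (1 + C₁)) +
      (1 - η) * ((1 + C₁ * (1 + η * β) - (1 + C₁)) / (1 + C₁)) =
      -(C₁ * η ^ 2 * β / (1 + C₁)) := by
    ring
  have hnonneg : 0 ≤ C₁ * η ^ 2 * β / (1 + C₁) := by positivity
  linarith [mul_le_mul_of_nonneg_left hcomm hη₀,
    mul_le_mul_of_nonneg_left hsense (sub_nonneg.2 hη₁)]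

theorem hasDerivAt_Rhat_zero {C₁ D₂ D₃ : ℝ} (hC : 0 < C₁) (hD₂ : 0 < D₂) (hD₃ : 0 < D₃)
    (η : ℝ) :
    HasDerivAt (fun β => Rhat C₁ (C₁ / Real.sqrt (D₂ * D₃)) D₂ D₃ η β)
      (η * C₁ * ((1 - η) * (1 / D₂ + 1 / D₃) / 2 - 1) / (1 + C₁) / Real.log 2) 0 := by
  have hP : 0 < D₂ * D₃ := mul_pos hD₂ hD₃
  have hS : 0 < Real.sqrt (D₂ * D₃) := Real.sqrt_pos.2 hP
  have hSS : Real.sqrt (D₂ * D₃) ^ 2 = D₂ * D₃ := Real.sq_sqrt hP.le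
  have hC' : 1 + C₁ ≠ 0 := by positivity
  simp only [Rhat_eq_log_div]
  have hcomm : HasDerivAt (fun β : ℝ => Real.log (1 + C₁ * (1 - β))) (-C₁ / (1 + C₁)) 0 := by
    have h := ((((hasDerivAt_id (0 : ℝ)).const_sub 1).const_mul C₁).const_add 1).log
      (by simpa using hC')
    simpa using h
  have hlin (D : ℝ) : HasDerivAt (fun β : ℝ => η * β + D) η 0 := by
    simpa using ((hasDerivAt_id (0 : ℝ)).const_mul η).add_const D
  have hsense : HasDerivAt (fun β : ℝ => Real.log (1 + C₁ / Real.sqrt (D₂ * D₃) *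
      Real.sqrt ((η * β + D₂) * (η * β + D₃))))
      (η * C₁ * (1 / D₂ + 1 / D₃) / 2 / (1 + C₁)) 0 := by
    have h := (((((hlin D₂).mul (hlin D₃)).sqrt (by simpa using hP.ne')).const_mul
      (C₁ / Real.sqrt (D₂ * D₃))).const_add 1).log
      (by simpa [div_mul_cancel₀ _ hS.ne'] using hC')
    refine h.congr_deriv ?_
    simp only [Pi.mul_apply, mul_zero, zero_add, div_mul_cancel₀ _ hS.ne']
    congr 1
    rw [div_mul_div_comm, show Real.sqrt (D₂ * D₃) * (2 * Real.sqrt (D₂ * D₃)) =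
      2 * Real.sqrt (D₂ * D₃) ^ 2 by ring, hSS]
    field_simp
  refine (((hcomm.const_mul η).add (hsense.const_mul (1 - η))).div_const
    (Real.log 2)).congr_deriv ?_
  ring

/-- Theorem 1: with `D₁ = C₁/√(D₂·D₃)`, a strictly positive sensing time `η > 0` can
strictly improve on the no-sensing rate `log₂(1 + C₁)` if and only if `1/D₂ + 1/D₃ > 2`;
moreover `R̂(0, β) = log₂(1 + C₁)` for every `β ∈ [0,1]`. -/
theorem stmt7 (C₁ D₂ D₃ : ℝ) (hC : 0 < C₁) (hD₂ : 0 < D₂) (hD₃ : 0 < D₃) :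
    (∀ β ∈ Set.Icc (0:ℝ) 1,
      Rhat C₁ (C₁ / Real.sqrt (D₂ * D₃)) D₂ D₃ 0 β = Real.logb 2 (1 + C₁)) ∧
    ((∃ η ∈ Set.Ioc (0:ℝ) 1, ∃ β ∈ Set.Icc (0:ℝ) 1,
        Real.logb 2 (1 + C₁) < Rhat C₁ (C₁ / Real.sqrt (D₂ * D₃)) D₂ D₃ η β) ↔
      2 < 1 / D₂ + 1 / D₃) := by
  refine ⟨fun β _ => Rhat_eq_of_eq_zero_or_eq_zero hD₂ hD₃ (.inl rfl), ?_, fun h => ?_⟩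
  · rintro ⟨η, hη, β, hβ, hlt⟩
    by_contra! h
    exact hlt.not_ge (Rhat_le hC hD₂ hD₃ (Set.Ioc_subset_Icc_self hη) hβ h)
  · obtain ⟨η, hη₀, hη₁⟩ : ∃ η : ℝ, 0 < η ∧ η < 1 - 2 / (1 / D₂ + 1 / D₃) :=
      exists_between (sub_pos.2 ((div_lt_one (by linarith)).2 h))
    have hpos : 0 < 1 / D₂ + 1 / D₃ := by linarith
    have hgain : 2 < (1 - η) * (1 / D₂ + 1 / D₃) := by
      rw [← div_lt_iff₀ hpos]
      linarith
    have hderiv : 0 < η * C₁ * ((1 - η) * (1 / D₂ + 1 / D₃) / 2 - 1) / (1 + C₁) / Real.log 2 :=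
      div_pos (div_pos (mul_pos (mul_pos hη₀ hC) (by linarith)) (by linarith))
        (Real.log_pos one_lt_two)
    obtain ⟨β, hβ, hlt⟩ :=
      (hasDerivAt_Rhat_zero hC hD₂ hD₃ η).exists_mem_Ioc_lt hderiv one_pos
    rw [Rhat_eq_of_eq_zero_or_eq_zero hD₂ hD₃ (.inr rfl)] at hlt
    exact ⟨η, ⟨hη₀, by linarith [div_pos two_pos hpos]⟩, β, Set.Ioc_subset_Icc_self hβ, hlt⟩
end

section
/- Let C₁ > 0, D₂ > 0, D₃ > 0 and D₁ = C₁/√(D₂·D₃). Define g(β) = log₂(1 + C₁(1 − β)) − log₂(1 + C₁) + D₁·(D₂ + D₃)·β / (2·√(D₂·D₃)·(1 + C₁)·ln 2) for β ∈ [0, 1]. Then: (i) g is concave on [0, 1]; (ii) g(0) = 0; and (iii) g(β) ≤ 0 for all β ∈ [0, 1] if and only if 1/D₂ + 1/D₃ ≤ 2 (equivalently, there exists β ∈ (0, 1] with g(β) > 0 if and only if 1/D₂ + 1/D₃ > 2). -/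
/-- The function `g(β) = ∂R̂(η,β)/∂η |_{η=0}` from Appendix E of the paper. -/
noncomputable def gfun (C₁ D₁ D₂ D₃ β : ℝ) : ℝ :=
  Real.logb 2 (1 + C₁ * (1 - β)) - Real.logb 2 (1 + C₁) +
    D₁ * (D₂ + D₃) * β / (2 * Real.sqrt (D₂ * D₃) * (1 + C₁) * Real.log 2)

/-- On `[0, 1]`, the function `gfun` only involves `C₁ / (1 + C₁)` and `1 / D₂ + 1 / D₃`. -/
lemma gfun_eq_log_add_linear {C₁ D₂ D₃ β : ℝ} (hC : 0 < C₁) (hD₂ : 0 < D₂) (hD₃ : 0 < D₃)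
    (hβ : β ∈ Set.Icc (0 : ℝ) 1) :
    gfun C₁ (C₁ / Real.sqrt (D₂ * D₃)) D₂ D₃ β =
      (Real.log (1 - C₁ / (1 + C₁) * β) + C₁ / (1 + C₁) * ((1 / D₂ + 1 / D₃) / 2) * β) /
        Real.log 2 := by
  have hlog : 0 < Real.log 2 := Real.log_pos one_lt_two
  have hs : 0 < Real.sqrt (D₂ * D₃) := Real.sqrt_pos.2 (mul_pos hD₂ hD₃)
  have hs2 : Real.sqrt (D₂ * D₃) ^ 2 = D₂ * D₃ := Real.sq_sqrt (mul_pos hD₂ hD₃).le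
  have hnum : 0 < 1 + C₁ * (1 - β) := by nlinarith [hβ.2]
  have hquot : 1 - C₁ / (1 + C₁) * β = (1 + C₁ * (1 - β)) / (1 + C₁) := by
    field_simp
    ring
  have hlin : C₁ / Real.sqrt (D₂ * D₃) * (D₂ + D₃) * β /
      (2 * Real.sqrt (D₂ * D₃) * (1 + C₁) * Real.log 2) =
      C₁ / (1 + C₁) * ((1 / D₂ + 1 / D₃) / 2) * β / Real.log 2 := by
    field_simp
    rw [hs2]
    ring
  rw [gfun, hlin, hquot, Real.log_div hnum.ne' (by positivity), Real.logb, Real.logb]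
  ring

/-- `β ↦ log (1 - a * β) + c * β` is concave on `[0, 1]` when `0 ≤ a < 1`. -/
lemma concaveOn_log_one_sub_mul_add {a : ℝ} (ha₀ : 0 ≤ a) (ha₁ : a < 1) (c : ℝ) :
    ConcaveOn ℝ (Set.Icc (0 : ℝ) 1) (fun β => Real.log (1 - a * β) + c * β) := by
  refine ⟨convex_Icc 0 1, fun x hx y hy s t hs ht hst => ?_⟩
  have hpos : ∀ z ∈ Set.Icc (0 : ℝ) 1, 1 - a * z ∈ Set.Ioi (0 : ℝ) := fun z hz => by
    rw [Set.mem_Ioi]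
    nlinarith [hz.1, hz.2]
  have h := strictConcaveOn_log_Ioi.concaveOn.2 (hpos x hx) (hpos y hy) hs ht hst
  simp only [smul_eq_mul] at h ⊢
  have harg : s * (1 - a * x) + t * (1 - a * y) = 1 - a * (s * x + t * y) := by
    linear_combination hst
  rw [harg] at h
  linarith

/-- Appendix E key claim: with `D₁ = C₁/√(D₂·D₃)`, the function `g` is concave on `[0,1]`,
vanishes at `0`, and is nonpositive on `[0,1]` iff `1/D₂ + 1/D₃ ≤ 2` (equivalently, some
`β ∈ (0,1]` makes `g(β) > 0` iff `1/D₂ + 1/D₃ > 2`). -/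
theorem stmt8 (C₁ D₂ D₃ : ℝ) (hC : 0 < C₁) (hD₂ : 0 < D₂) (hD₃ : 0 < D₃) :
    ConcaveOn ℝ (Set.Icc 0 1) (fun β => gfun C₁ (C₁ / Real.sqrt (D₂ * D₃)) D₂ D₃ β) ∧
    gfun C₁ (C₁ / Real.sqrt (D₂ * D₃)) D₂ D₃ 0 = 0 ∧
    ((∀ β ∈ Set.Icc (0:ℝ) 1, gfun C₁ (C₁ / Real.sqrt (D₂ * D₃)) D₂ D₃ β ≤ 0) ↔
      1 / D₂ + 1 / D₃ ≤ 2) ∧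
    ((∃ β ∈ Set.Ioc (0:ℝ) 1, 0 < gfun C₁ (C₁ / Real.sqrt (D₂ * D₃)) D₂ D₃ β) ↔
      2 < 1 / D₂ + 1 / D₃) := by
  have hlog : 0 < Real.log 2 := Real.log_pos one_lt_two
  have heq := fun β hβ => gfun_eq_log_add_linear (β := β) hC hD₂ hD₃ hβ
  have ha₀ : 0 < C₁ / (1 + C₁) := by positivity
  have ha₁ : C₁ / (1 + C₁) < 1 := by
    rw [div_lt_one (by positivity)]
    linarith
  set a := C₁ / (1 + C₁)
  set S := 1 / D₂ + 1 / D₃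
  have hnonpos : S ≤ 2 → ∀ β ∈ Set.Icc (0 : ℝ) 1,
      gfun C₁ (C₁ / Real.sqrt (D₂ * D₃)) D₂ D₃ β ≤ 0 := by
    intro hS β hβ
    rw [heq β hβ]
    have hpos : 0 < 1 - a * β := by nlinarith [hβ.1, hβ.2]
    have hle := Real.log_le_sub_one_of_pos hpos
    refine div_nonpos_of_nonpos_of_nonneg ?_ hlog.le
    nlinarith [mul_nonneg (mul_nonneg ha₀.le hβ.1) (sub_nonneg.2 hS)]
  have hexists : 2 < S → ∃ β ∈ Set.Ioc (0 : ℝ) 1,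
      0 < gfun C₁ (C₁ / Real.sqrt (D₂ * D₃)) D₂ D₃ β := by
    intro hS
    have hS₀ : 0 < S := by linarith
    have hβ₀ : 0 < 1 - 2 / S := by
      rw [sub_pos, div_lt_one hS₀]
      exact hS
    have hS' : 0 < 2 / S := by positivity
    refine ⟨1 - 2 / S, ⟨hβ₀, by linarith⟩, ?_⟩
    rw [heq _ ⟨hβ₀.le, by linarith⟩]
    set β := 1 - 2 / S with hβ
    have hlt : 2 / S < 1 - a * β := by nlinarith
    have hpos : 0 < 1 - a * β := hS'.trans hlt
    have hle := Real.one_sub_inv_le_log_of_pos hpos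
    have hinv : (1 - a * β)⁻¹ < S / 2 := by
      rw [← inv_div 2 S]
      exact inv_strictAnti₀ hS' hlt
    have hid : 1 - (1 - a * β)⁻¹ = -(a * β * (1 - a * β)⁻¹) := by
      field_simp
      ring
    refine div_pos ?_ hlog
    nlinarith [mul_lt_mul_of_pos_left hinv (mul_pos ha₀ hβ₀)]
  refine ⟨?_, by simp [gfun], ⟨fun h => ?_, hnonpos⟩, ⟨fun ⟨β, hβ, hg⟩ => ?_, hexists⟩⟩
  · refine ((concaveOn_log_one_sub_mul_add ha₀.le ha₁ (a * (S / 2))).smul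
      (inv_nonneg.2 hlog.le)).congr fun β hβ => ?_
    exact (div_eq_inv_mul _ _).symm.trans (heq β hβ).symm
  · by_contra! hS
    obtain ⟨β, hβ, hg⟩ := hexists hS
    exact (h β (Set.Ioc_subset_Icc_self hβ)).not_gt hg
  · by_contra! hS
    exact (hnonpos hS β (Set.Ioc_subset_Icc_self hβ)).not_gt hg
end

section
/- Let C₁ > 0, D₂ > 0, D₃ > 0, D₁ = C₁/√(D₂·D₃), and define R̂(η, β) = η·log₂(1 + C₁(1 − β)) + (1 − η)·log₂(1 + D₁·√((ηβ + D₂)(ηβ + D₃))) on [0,1]×[0,1]. Then for every fixed η ∈ [0, 1], the map β ↦ R̂(η, β) is concave on [0, 1], and for every fixed β ∈ [0, 1], the map η ↦ R̂(η, β) is concave on [0, 1]. -/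
/-- The logarithm to base `2` of a positive concave function is concave. -/
theorem ConcaveOn.logb_two_comp {s : Set ℝ} {f : ℝ → ℝ} (hf : ConcaveOn ℝ s f)
    (hpos : ∀ x ∈ s, 0 < f x) : ConcaveOn ℝ s (fun x => Real.logb 2 (f x)) := by
  refine ⟨hf.1, fun x hx y hy a b ha hb hab => ?_⟩
  have hlog := strictConcaveOn_log_Ioi.concaveOn.2 (hpos x hx) (hpos y hy) ha hb hab
  have hmid : 0 < a • f x + b • f y := (convex_Ioi (0 : ℝ)) (hpos x hx) (hpos y hy) ha hb hab
  have hle := hlog.trans (Real.log_le_log hmid (hf.2 hx hy ha hb hab))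
  simp only [smul_eq_mul, Real.logb] at hle ⊢
  rw [← mul_div_assoc, ← mul_div_assoc, ← add_div]
  exact div_le_div_of_nonneg_right hle (Real.log_nonneg one_le_two)

/-- The geometric mean of two nonnegative translates of the identity is concave. -/
theorem concaveOn_sqrt_add_mul_add {p q : ℝ} (hp : 0 ≤ p) (hq : 0 ≤ q) :
    ConcaveOn ℝ (Set.Ici 0) (fun t : ℝ => √((t + p) * (t + q))) := by
  refine ⟨convex_Ici 0, fun x hx y hy a b ha hb hab => ?_⟩
  rw [Set.mem_Ici] at hx hy
  have hX : 0 ≤ (x + p) * (x + q) := by positivity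
  have hY : 0 ≤ (y + p) * (y + q) := by positivity
  have hcross : √((x + p) * (x + q)) * √((y + p) * (y + q)) ≤
      ((x + p) * (y + q) + (y + p) * (x + q)) / 2 := by
    rw [← Real.sqrt_mul hX]
    refine Real.sqrt_le_iff.2 ⟨by positivity, ?_⟩
    nlinarith [sq_nonneg ((x + p) * (y + q) - (y + p) * (x + q))]
  simp only [smul_eq_mul]
  refine Real.le_sqrt_of_sq_le ?_
  have hb' : b = 1 - a := by linarith
  calc (a * √((x + p) * (x + q)) + b * √((y + p) * (y + q))) ^ 2
      = a ^ 2 * √((x + p) * (x + q)) ^ 2 + b ^ 2 * √((y + p) * (y + q)) ^ 2 +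
          2 * (a * b) * (√((x + p) * (x + q)) * √((y + p) * (y + q))) := by ring
    _ ≤ a ^ 2 * ((x + p) * (x + q)) + b ^ 2 * ((y + p) * (y + q)) +
          2 * (a * b) * (((x + p) * (y + q) + (y + p) * (x + q)) / 2) := by
        rw [Real.sq_sqrt hX, Real.sq_sqrt hY]
        gcongr
    _ = (a * x + b * y + p) * (a * x + b * y + q) := by subst hb'; ring

/-- Rescaling the argument by a nonnegative factor preserves concavity on `[0, ∞)`. -/
theorem ConcaveOn.comp_mul_left_Ici {f : ℝ → ℝ} (hf : ConcaveOn ℝ (Set.Ici 0) f) {c : ℝ}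
    (hc : 0 ≤ c) : ConcaveOn ℝ (Set.Ici 0) (fun x => f (c * x)) :=
  (hf.comp_linearMap (LinearMap.mul ℝ ℝ c)).subset (fun _ hx => mul_nonneg hc hx) (convex_Ici 0)

theorem concaveOn_logb_sqrt_add_mul_add {c p q : ℝ} (hc : 0 ≤ c) (hp : 0 ≤ p) (hq : 0 ≤ q) :
    ConcaveOn ℝ (Set.Ici 0) (fun t : ℝ => Real.logb 2 (1 + c * √((t + p) * (t + q)))) := by
  refine ConcaveOn.logb_two_comp ?_ fun x _ => by positivity
  exact (concaveOn_const 1 (convex_Ici 0)).add ((concaveOn_sqrt_add_mul_add hp hq).smul hc)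

theorem monotoneOn_logb_sqrt_add_mul_add {c p q : ℝ} (hc : 0 ≤ c) (hp : 0 ≤ p) (hq : 0 ≤ q) :
    MonotoneOn (fun t : ℝ => Real.logb 2 (1 + c * √((t + p) * (t + q)))) (Set.Ici 0) := by
  intro x hx y hy hxy
  rw [Set.mem_Ici] at hx hy
  refine Real.logb_le_logb_of_le one_lt_two (by positivity) ?_
  gcongr

/-- Biconcavity of `R̂` (Appendix E): for each fixed `η ∈ [0,1]` the map `β ↦ R̂(η,β)` is
concave on `[0,1]`, and for each fixed `β ∈ [0,1]` the map `η ↦ R̂(η,β)` is concave on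
`[0,1]`, where `D₁ = C₁/√(D₂·D₃)`. -/
theorem stmt9 (C₁ D₂ D₃ : ℝ) (hC : 0 < C₁) (hD₂ : 0 < D₂) (hD₃ : 0 < D₃) :
    (∀ η ∈ Set.Icc (0:ℝ) 1,
      ConcaveOn ℝ (Set.Icc 0 1)
        (fun β => Rhat C₁ (C₁ / Real.sqrt (D₂ * D₃)) D₂ D₃ η β)) ∧
    (∀ β ∈ Set.Icc (0:ℝ) 1,
      ConcaveOn ℝ (Set.Icc 0 1)
        (fun η => Rhat C₁ (C₁ / Real.sqrt (D₂ * D₃)) D₂ D₃ η β)) := by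
  have hc : 0 ≤ C₁ / √(D₂ * D₃) := by positivity
  have hψ := concaveOn_logb_sqrt_add_mul_add hc hD₂.le hD₃.le
  have hmono := monotoneOn_logb_sqrt_add_mul_add hc hD₂.le hD₃.le
  have hI : Set.Icc (0 : ℝ) 1 ⊆ Set.Ici 0 := Set.Icc_subset_Ici_self
  have hconv : Convex ℝ (Set.Icc (0 : ℝ) 1) := convex_Icc 0 1
  have hsub : ConcaveOn ℝ (Set.Icc (0 : ℝ) 1) (fun x => 1 - x) :=
    (concaveOn_const (1 : ℝ) hconv).sub (convexOn_id hconv)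
  refine ⟨fun η hη => ?_, fun β hβ => ?_⟩
  · have hlog : ConcaveOn ℝ (Set.Icc (0 : ℝ) 1) (fun β => Real.logb 2 (1 + C₁ * (1 - β))) := by
      refine ConcaveOn.logb_two_comp ((concaveOn_const 1 hconv).add (hsub.smul hC.le)) ?_
      intro x hx
      exact add_pos_of_pos_of_nonneg one_pos (mul_nonneg hC.le (sub_nonneg.2 hx.2))
    exact (hlog.smul hη.1).add
      (((hψ.comp_mul_left_Ici hη.1).subset hI hconv).smul (sub_nonneg.2 hη.2))
  · have hψβ : ConcaveOn ℝ (Set.Icc (0 : ℝ) 1) (fun η => Real.logb 2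
        (1 + C₁ / √(D₂ * D₃) * √((η * β + D₂) * (η * β + D₃)))) := by
      simpa only [mul_comm β] using (hψ.comp_mul_left_Ici hβ.1).subset hI hconv
    have hlin : ConcaveOn ℝ (Set.Icc (0 : ℝ) 1)
        (fun η => η * Real.logb 2 (1 + C₁ * (1 - β))) := by
      have hL : 0 ≤ Real.logb 2 (1 + C₁ * (1 - β)) :=
        Real.logb_nonneg one_lt_two
          (le_add_of_nonneg_right (mul_nonneg hC.le (sub_nonneg.2 hβ.2)))
      simpa only [smul_eq_mul, mul_comm, id] using (concaveOn_id hconv).smul hL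
    refine hlin.add (hsub.mul hψβ (fun x hx => sub_nonneg.2 hx.2) (fun x hx => ?_) ?_)
    · exact Real.logb_nonneg one_lt_two (le_add_of_nonneg_right (by positivity))
    · refine AntitoneOn.antivaryOn (fun x _ y _ hxy => sub_le_sub_left hxy 1) ?_
      intro x hx y hy hxy
      exact hmono (mul_nonneg hx.1 hβ.1) (mul_nonneg hy.1 hβ.1)
        (mul_le_mul_of_nonneg_right hxy hβ.1)
end

section
/- Let φ ∈ (0, π) and σ > 0, let ω be a real Gaussian random variable with mean 0 and variance σ², and set Y = 2·cos(φ + ω) − 2·cos φ. Then Y has a probability density function which, at every y in the open interval (−2 − 2cos φ, 2 − 2cos φ), equals P_φ(y) = ∑_{i ∈ ℤ} [1/√(1 − (y/2 + cos φ)²)] · [1/(2·√(2π)·σ)] · ( exp(−(2(i+1)π − arccos(y/2 + cos φ) − φ)²/(2σ²)) + exp(−(2iπ + arccos(y/2 + cos φ) − φ)²/(2σ²)) ). -/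
open MeasureTheory ProbabilityTheory

/-- Unfolding an integral over the line along the even `2π`-periodic tiling by copies of
`(0, π)`. -/
theorem lintegral_eq_lintegral_Ioo_tsum_fold {H : ℝ → ENNReal} (hH : Measurable H) :
    ∫⁻ x, H x = ∫⁻ t in Set.Ioo 0 Real.pi,
      ∑' i : ℤ, (H (2 * ((i : ℝ) + 1) * Real.pi - t) + H (2 * (i : ℝ) * Real.pi + t)) := by
  have hpi := Real.pi_pos
  rw [lintegral_tsum (fun i => by fun_prop), ← setLIntegral_univ,
    ← iUnion_Ioc_zsmul (mul_pos two_pos hpi),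
    lintegral_iUnion (fun i => measurableSet_Ioc) (Set.pairwise_disjoint_Ioc_zsmul _)]
  refine tsum_congr fun i => ?_
  have hleft := (measurePreserving_add_left volume
    (2 * (i : ℝ) * Real.pi)).setLIntegral_comp_preimage_emb (measurableEmbedding_addLeft _) H
    (Set.Ioo (2 * (i : ℝ) * Real.pi) (2 * (i : ℝ) * Real.pi + Real.pi))
  have hright := (Measure.measurePreserving_sub_left volume
    (2 * ((i : ℝ) + 1) * Real.pi)).setLIntegral_comp_preimage_emb
    (MeasurableEquiv.subLeft _).measurableEmbedding H
    (Set.Ioo (2 * (i : ℝ) * Real.pi + Real.pi) (2 * ((i : ℝ) + 1) * Real.pi))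
  rw [Set.preimage_const_add_Ioo, sub_self, add_sub_cancel_left] at hleft
  rw [Set.preimage_const_sub_Ioo, sub_self,
    show 2 * ((i : ℝ) + 1) * Real.pi - (2 * (i : ℝ) * Real.pi + Real.pi) = Real.pi by ring]
    at hright
  rw [lintegral_add_left (by fun_prop), hleft, hright, setLIntegral_congr Ioo_ae_eq_Ioc,
    setLIntegral_congr (Ioo_ae_eq_Ioc (a := 2 * (i : ℝ) * Real.pi)),
    add_comm (lintegral _ _),
    ← lintegral_union measurableSet_Ioc (Set.Ioc_disjoint_Ioc_of_le le_rfl),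
    Set.Ioc_union_Ioc_eq_Ioc (by linarith) (by linarith)]
  congr 3 <;> simp only [zsmul_eq_mul] <;> push_cast <;> ring

/-- The substitution `y = 2 cos t - 2 c` with `t ∈ (0, π)`. -/
theorem lintegral_Ioo_eq_lintegral_two_mul_cos_sub (c : ℝ) (g : ℝ → ENNReal) :
    ∫⁻ y in Set.Ioo (-2 - 2 * c) (2 - 2 * c), g y = ∫⁻ t in Set.Ioo 0 Real.pi,
      ENNReal.ofReal (2 * Real.sin t) * g (2 * Real.cos t - 2 * c) := by
  have himage : (fun t => 2 * Real.cos t - 2 * c) '' Set.Ioo 0 Real.pi =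
      Set.Ioo (-2 - 2 * c) (2 - 2 * c) := by
    ext y
    constructor
    · rintro ⟨t, ht, rfl⟩
      have h1 := Real.strictAntiOn_cos (Set.left_mem_Icc.2 Real.pi_pos.le)
        (Set.Ioo_subset_Icc_self ht) ht.1
      have h2 := Real.strictAntiOn_cos (Set.Ioo_subset_Icc_self ht)
        (Set.right_mem_Icc.2 Real.pi_pos.le) ht.2
      rw [Real.cos_zero] at h1
      rw [Real.cos_pi] at h2
      constructor <;> dsimp only <;> linarith
    · rintro ⟨h1, h2⟩
      refine ⟨Real.arccos (y / 2 + c), ⟨Real.arccos_pos.2 (by linarith), ?_⟩, ?_⟩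
      · refine lt_of_le_of_ne (Real.arccos_le_pi _) fun h => ?_
        rw [Real.arccos_eq_pi] at h
        linarith
      · dsimp only
        rw [Real.cos_arccos (by linarith) (by linarith)]
        ring
  have hderiv : ∀ t ∈ Set.Ioo 0 Real.pi, HasDerivWithinAt (fun t => 2 * Real.cos t - 2 * c)
      (2 * -Real.sin t) (Set.Ioo 0 Real.pi) t := fun t _ =>
    (((Real.hasDerivAt_cos t).const_mul 2).sub_const _).hasDerivWithinAt
  have hinj : Set.InjOn (fun t => 2 * Real.cos t - 2 * c) (Set.Ioo 0 Real.pi) := by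
    intro s hs t ht hst
    refine Real.injOn_cos (Set.Ioo_subset_Icc_self hs) (Set.Ioo_subset_Icc_self ht) ?_
    dsimp only at hst
    linarith
  rw [← himage, lintegral_image_eq_lintegral_abs_deriv_mul measurableSet_Ioo hderiv hinj]
  refine setLIntegral_congr_fun measurableSet_Ioo fun t ht => ?_
  have hsin := Real.sin_pos_of_mem_Ioo ht
  rw [abs_of_nonpos (by linarith)]
  congr 2
  ring

/-- The `i`-th summand of the density of `2 cos (φ + ω) - 2 cos φ` for a centred Gaussian `ω`
of standard deviation `σ`. -/
noncomputable def cosDiffDensityTerm (φ σ : ℝ) (i : ℤ) (y : ℝ) : ℝ :=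
  (1 / Real.sqrt (1 - (y / 2 + Real.cos φ) ^ 2)) *
    (1 / (2 * Real.sqrt (2 * Real.pi) * σ)) *
    (Real.exp (-(2 * ((i : ℝ) + 1) * Real.pi -
        Real.arccos (y / 2 + Real.cos φ) - φ) ^ 2 / (2 * σ ^ 2)) +
     Real.exp (-(2 * (i : ℝ) * Real.pi +
        Real.arccos (y / 2 + Real.cos φ) - φ) ^ 2 / (2 * σ ^ 2)))

theorem measurable_cosDiffDensityTerm (φ σ : ℝ) (i : ℤ) :
    Measurable (cosDiffDensityTerm φ σ i) := by
  have := Real.continuous_arccos.measurable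
  unfold cosDiffDensityTerm
  fun_prop

theorem cosDiffDensityTerm_nonneg (φ : ℝ) {σ : ℝ} (hσ : 0 < σ) (i : ℤ) (y : ℝ) :
    0 ≤ cosDiffDensityTerm φ σ i y := by
  unfold cosDiffDensityTerm
  positivity

theorem gaussianPDF_zero_of_coe_eq_sq {σ : ℝ} {v : NNReal} (hσ : 0 < σ)
    (hv : (v : ℝ) = σ ^ 2) (x : ℝ) :
    gaussianPDF 0 v x = ENNReal.ofReal
      (1 / (Real.sqrt (2 * Real.pi) * σ) * Real.exp (-x ^ 2 / (2 * σ ^ 2))) := by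
  rw [gaussianPDF, gaussianPDFReal]
  congr 1
  rw [sub_zero, hv, Real.sqrt_mul (by positivity), Real.sqrt_sq hσ.le, one_div]

theorem ofReal_two_sin_mul_cosDiffDensityTerm (φ : ℝ) {σ t : ℝ} {v : NNReal} (hσ : 0 < σ)
    (hv : (v : ℝ) = σ ^ 2) (ht : t ∈ Set.Ioo 0 Real.pi) (i : ℤ) :
    ENNReal.ofReal (2 * Real.sin t) *
        ENNReal.ofReal (cosDiffDensityTerm φ σ i (2 * Real.cos t - 2 * Real.cos φ)) =
      gaussianPDF 0 v (2 * ((i : ℝ) + 1) * Real.pi - t - φ) +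
        gaussianPDF 0 v (2 * (i : ℝ) * Real.pi + t - φ) := by
  have hsin := Real.sin_pos_of_mem_Ioo ht
  rw [gaussianPDF_zero_of_coe_eq_sq hσ hv, gaussianPDF_zero_of_coe_eq_sq hσ hv,
    ← ENNReal.ofReal_add (by positivity) (by positivity), ← ENNReal.ofReal_mul (by positivity)]
  congr 1
  rw [cosDiffDensityTerm,
    show (2 * Real.cos t - 2 * Real.cos φ) / 2 + Real.cos φ = Real.cos t by ring,
    Real.arccos_cos ht.1.le ht.2.le, ← Real.sin_sq, Real.sqrt_sq hsin.le]
  field_simp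

theorem map_two_cos_sub_gaussianReal (φ : ℝ) {σ : ℝ} {v : NNReal} (hσ : 0 < σ)
    (hv : (v : ℝ) = σ ^ 2) :
    Measure.map (fun ω : ℝ => 2 * Real.cos (φ + ω) - 2 * Real.cos φ)
        (gaussianReal 0 v) =
      volume.withDensity ((Set.Ioo (-2 - 2 * Real.cos φ) (2 - 2 * Real.cos φ)).indicator
        fun y => ∑' i : ℤ, ENNReal.ofReal (cosDiffDensityTerm φ σ i y)) := by
  have hv₀ : v ≠ 0 := by
    rintro rfl
    exact (pow_pos hσ 2).ne hv
  ext A hA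
  have hmeas : Measurable fun ω : ℝ => 2 * Real.cos (φ + ω) - 2 * Real.cos φ := by fun_prop
  set G := gaussianPDF 0 v with hG
  have hGm : Measurable G := measurable_gaussianPDF _ _
  set χ : ℝ → ENNReal := A.indicator 1 with hχ
  have hχm : Measurable χ := measurable_one.indicator hA
  set H : ℝ → ENNReal := fun θ => χ (2 * Real.cos θ - 2 * Real.cos φ) * G (θ - φ) with hH
  have hHm : Measurable H := by fun_prop
  have hleft : Measure.map (fun ω : ℝ => 2 * Real.cos (φ + ω) - 2 * Real.cos φ)
      (gaussianReal 0 v) A = ∫⁻ θ, H θ := by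
    rw [Measure.map_apply hmeas hA, gaussianReal_of_var_ne_zero _ hv₀,
      withDensity_apply _ (hmeas hA), ← lintegral_indicator (hmeas hA),
      ← lintegral_add_left_eq_self H φ]
    refine lintegral_congr fun ω => ?_
    by_cases h : 2 * Real.cos (φ + ω) - 2 * Real.cos φ ∈ A <;>
      simp [hH, hχ, Set.indicator, h, hG]
  have hright : (volume.withDensity
      ((Set.Ioo (-2 - 2 * Real.cos φ) (2 - 2 * Real.cos φ)).indicator
        fun y => ∑' i : ℤ, ENNReal.ofReal (cosDiffDensityTerm φ σ i y))) A =
      ∫⁻ y in Set.Ioo (-2 - 2 * Real.cos φ) (2 - 2 * Real.cos φ),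
        χ y * ∑' i : ℤ, ENNReal.ofReal (cosDiffDensityTerm φ σ i y) := by
    rw [withDensity_apply _ hA, ← lintegral_indicator hA, ← lintegral_indicator measurableSet_Ioo]
    refine lintegral_congr fun y => ?_
    by_cases h : y ∈ A <;> simp [hχ, Set.indicator, h]
  rw [hleft, hright, lintegral_eq_lintegral_Ioo_tsum_fold hHm,
    lintegral_Ioo_eq_lintegral_two_mul_cos_sub]
  refine setLIntegral_congr_fun measurableSet_Ioo fun t ht => ?_
  rw [mul_left_comm, ← ENNReal.tsum_mul_left, ← ENNReal.tsum_mul_left]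
  refine tsum_congr fun i => ?_
  have hcos₁ : Real.cos (2 * ((i : ℝ) + 1) * Real.pi - t) = Real.cos t := by
    rw [← Real.cos_int_mul_two_pi_sub t (i + 1)]
    push_cast
    ring_nf
  have hcos₂ : Real.cos (2 * (i : ℝ) * Real.pi + t) = Real.cos t := by
    rw [← Real.cos_add_int_mul_two_pi t i]
    ring_nf
  rw [ofReal_two_sin_mul_cosDiffDensityTerm φ hσ hv ht]
  simp only [hH, hcos₁, hcos₂, hG]
  exact (mul_add _ _ _).symm

/-- Density formula (28)–(29) of Appendix C: if `ω ~ N(0, σ²)` and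
`Y = 2·cos(φ + ω) − 2·cos φ`, then `Y` has a density which on the open interval
`(−2 − 2cos φ, 2 − 2cos φ)` equals the wrapped-Gaussian change-of-variables formula
`P_φ(y)`. -/
theorem stmt11 (φ σ : ℝ) (hφ : φ ∈ Set.Ioo 0 Real.pi) (hσ : 0 < σ) :
    ∃ p : ℝ → ℝ,
      (Measure.map (fun ω : ℝ => 2 * Real.cos (φ + ω) - 2 * Real.cos φ)
          (gaussianReal 0 ⟨σ ^ 2, sq_nonneg σ⟩)
        = MeasureTheory.volume.withDensity (fun y => ENNReal.ofReal (p y))) ∧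
      ∀ y ∈ Set.Ioo (-2 - 2 * Real.cos φ) (2 - 2 * Real.cos φ),
        p y = ∑' i : ℤ,
          (1 / Real.sqrt (1 - (y / 2 + Real.cos φ) ^ 2)) *
            (1 / (2 * Real.sqrt (2 * Real.pi) * σ)) *
            (Real.exp (-(2 * ((i : ℝ) + 1) * Real.pi -
                Real.arccos (y / 2 + Real.cos φ) - φ) ^ 2 / (2 * σ ^ 2)) +
             Real.exp (-(2 * (i : ℝ) * Real.pi +
                Real.arccos (y / 2 + Real.cos φ) - φ) ^ 2 / (2 * σ ^ 2))) := by
  obtain ⟨v, hv, hvσ⟩ : ∃ v : NNReal, (v : ℝ) = σ ^ 2 ∧ v = ⟨σ ^ 2, sq_nonneg σ⟩ :=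
    ⟨⟨σ ^ 2, sq_nonneg σ⟩, rfl, rfl⟩
  rw [← hvσ]
  set F : ℝ → ENNReal := (Set.Ioo (-2 - 2 * Real.cos φ) (2 - 2 * Real.cos φ)).indicator
    fun y => ∑' i : ℤ, ENNReal.ofReal (cosDiffDensityTerm φ σ i y) with hF
  have hFm : Measurable F := by
    refine Measurable.indicator (Measurable.tsum fun i => ?_) measurableSet_Ioo
    exact (measurable_cosDiffDensityTerm φ σ i).ennreal_ofReal
  have hmap := map_two_cos_sub_gaussianReal φ hσ hv
  have hfin : ∫⁻ y, F y ≠ ⊤ := by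
    rw [← setLIntegral_univ, ← withDensity_apply _ MeasurableSet.univ, hF, ← hmap]
    have : IsProbabilityMeasure (Measure.map
        (fun ω : ℝ => 2 * Real.cos (φ + ω) - 2 * Real.cos φ)
        (gaussianReal 0 v)) :=
      Measure.isProbabilityMeasure_map (by fun_prop)
    exact measure_ne_top _ _
  refine ⟨fun y => (F y).toReal, ?_, fun y hy => ?_⟩
  · rw [hmap]
    refine withDensity_congr_ae ?_
    filter_upwards [ae_lt_top hFm hfin] with y hy
    exact (ENNReal.ofReal_toReal hy.ne).symm
  · simp only [hF, Set.indicator_of_mem hy]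
    rw [ENNReal.tsum_toReal_eq fun i => ENNReal.ofReal_ne_top]
    exact tsum_congr fun i => ENNReal.toReal_ofReal (cosDiffDensityTerm_nonneg φ hσ i y)
end

section
/- Let φ ∈ (0, π) and σ > 0, and let ω be a real Gaussian random variable with mean 0 and variance σ². For a positive integer L define the Fejér kernel F_L(x) = (1/L)·(sin(Lπx/2)/sin(πx/2))² for x not an even integer, and F_L(x) = L for x an even integer. Then lim_{L→∞} E[ F_L( cos(φ + ω) − cos φ ) ] = 2·h(φ, σ²), where h(x, y) = (1/√(2π·y·sin²x)) · ∑_{i ∈ ℤ} ( exp(−2(iπ)²/y) + exp(−2((i+1)π − x)²/y) ). -/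
open MeasureTheory ProbabilityTheory Filter
open scoped Classical

/-- The Fejér kernel: `F_L(x) = (1/L)·(sin(Lπx/2)/sin(πx/2))²` for `x` not an even
integer, and `F_L(x) = L` for `x` an even integer. -/
noncomputable def fejer (L : ℕ) (x : ℝ) : ℝ :=
  if ∃ k : ℤ, x = 2 * k then (L : ℝ)
  else (1 / L) * (Real.sin (L * Real.pi * x / 2) / Real.sin (Real.pi * x / 2)) ^ 2

/-- The wrapped-Gaussian factor `h(x, y)` of the paper. -/
noncomputable def hfun (x y : ℝ) : ℝ :=
  (1 / Real.sqrt (2 * Real.pi * y * (Real.sin x) ^ 2)) *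
    ∑' i : ℤ, (Real.exp (-2 * ((i : ℝ) * Real.pi) ^ 2 / y) +
      Real.exp (-2 * (((i : ℝ) + 1) * Real.pi - x) ^ 2 / y))

/-- The modulus of the Dirichlet-type sum `∑ exp (ikθ)`, expanded as a double cosine sum. -/
lemma norm_sum_exp_sq (L : ℕ) (θ : ℝ) :
    ‖∑ k ∈ Finset.range L, Complex.exp (Complex.I * θ) ^ k‖ ^ 2 =
      ∑ j ∈ Finset.range L, ∑ k ∈ Finset.range L, Real.cos (((j : ℝ) - k) * θ) := by
  have hz : ∀ k : ℕ, Complex.exp (Complex.I * θ) ^ k =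
      Complex.exp ((((k : ℝ) * θ : ℝ) : ℂ) * Complex.I) := fun k => by
    rw [← Complex.exp_nat_mul]; congr 1; push_cast; ring
  rw [← Complex.normSq_eq_norm_sq, Complex.normSq_apply]
  simp only [hz, Complex.re_sum, Complex.im_sum, Complex.exp_ofReal_mul_I_re,
    Complex.exp_ofReal_mul_I_im, Finset.sum_mul_sum, ← Finset.sum_add_distrib]
  refine Finset.sum_congr rfl fun j _ => Finset.sum_congr rfl fun k _ => ?_
  rw [sub_mul, Real.cos_sub]

lemma sin_pi_mul_div_two_eq_zero_iff (x : ℝ) :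
    Real.sin (Real.pi * x / 2) = 0 ↔ ∃ k : ℤ, x = 2 * k := by
  rw [Real.sin_eq_zero_iff]
  refine exists_congr fun k => ⟨fun h => ?_, fun h => by rw [h]; ring⟩
  have h' : Real.pi * (x - 2 * k) = 0 := by linarith
  linarith [(mul_eq_zero.mp h').resolve_left Real.pi_ne_zero]

/-- The Fejér kernel as a trigonometric polynomial. -/
lemma fejer_eq_sum (L : ℕ) (x : ℝ) :
    fejer L x = (1 / L) * ∑ j ∈ Finset.range L, ∑ k ∈ Finset.range L,
      Real.cos (((j : ℝ) - k) * (Real.pi * x)) := by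
  unfold fejer
  split_ifs with h
  · obtain ⟨m, rfl⟩ := h
    have h1 : ∀ j k : ℕ, Real.cos (((j : ℝ) - k) * (Real.pi * (2 * m))) = 1 := fun j k => by
      rw [← Real.cos_int_mul_two_pi (((j : ℤ) - k) * m)]
      congr 1; push_cast; ring
    simp only [h1, Finset.sum_const, Finset.card_range, nsmul_eq_mul, mul_one]
    rcases eq_or_ne (L : ℝ) 0 with hL | hL
    · simp [hL]
    · field_simp
  · rw [← sin_pi_mul_div_two_eq_zero_iff] at h
    rw [← norm_sum_exp_sq]
    have hgeom := congrArg norm (geom_sum_mul (Complex.exp (Complex.I * (Real.pi * x : ℝ))) L)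
    have hpow : Complex.exp (Complex.I * (Real.pi * x : ℝ)) ^ L =
        Complex.exp (Complex.I * (L * (Real.pi * x) : ℝ)) := by
      rw [← Complex.exp_nat_mul]; congr 1; push_cast; ring
    rw [norm_mul, hpow, Complex.norm_exp_I_mul_ofReal_sub_one,
      Complex.norm_exp_I_mul_ofReal_sub_one, norm_mul, norm_mul, mul_left_comm,
      mul_right_inj' (by simp)] at hgeom
    rw [← eq_div_iff (norm_ne_zero_iff.mpr h), ← norm_div] at hgeom
    rw [hgeom, Real.norm_eq_abs, sq_abs, mul_assoc]

lemma continuous_fejer (L : ℕ) : Continuous (fejer L) := by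
  rw [funext (fejer_eq_sum L)]
  fun_prop

lemma fejer_nonneg (L : ℕ) (x : ℝ) : 0 ≤ fejer L x := by
  unfold fejer; split_ifs <;> positivity

lemma fejer_le (L : ℕ) (x : ℝ) : fejer L x ≤ L := by
  have h : ∑ j ∈ Finset.range L, ∑ k ∈ Finset.range L,
      Real.cos (((j : ℝ) - k) * (Real.pi * x)) ≤
      ∑ _j ∈ Finset.range L, ∑ _k ∈ Finset.range L, (1 : ℝ) :=
    Finset.sum_le_sum fun j _ => Finset.sum_le_sum fun k _ => Real.cos_le_one _
  simp only [Finset.sum_const, Finset.card_range, nsmul_eq_mul, mul_one] at h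
  rw [fejer_eq_sum]
  refine (mul_le_mul_of_nonneg_left h (by positivity)).trans_eq ?_
  rcases eq_or_ne (L : ℝ) 0 with hL | hL
  · simp [hL]
  · field_simp

/-- The Fejér kernel is `O(1/L)` away from the even integers. -/
lemma fejer_mul_sin_sq_le (L : ℕ) (x : ℝ) :
    fejer L x * Real.sin (Real.pi * x / 2) ^ 2 ≤ 1 / L := by
  unfold fejer
  split_ifs with h
  · rw [(sin_pi_mul_div_two_eq_zero_iff x).mpr h]; simp
  · rw [← sin_pi_mul_div_two_eq_zero_iff] at h
    rw [div_pow, mul_assoc, div_mul_cancel₀ _ (pow_ne_zero 2 h)]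
    exact mul_le_of_le_one_right (by positivity) (Real.sin_sq_le_one _)

/-- The Fejér kernel has mass `2` over each period. -/
lemma integral_fejer {L : ℕ} (hL : L ≠ 0) (p : ℝ) : ∫ x in p..p + 2, fejer L x = 2 := by
  have hcos : ∀ j k : ℕ, ∫ x in p..p + 2, Real.cos (((j : ℝ) - k) * (Real.pi * x)) =
      if j = k then 2 else 0 := fun j k => by
    split_ifs with h
    · simp [h]
    · have hjk : ((j : ℝ) - k) * Real.pi ≠ 0 :=
        mul_ne_zero (sub_ne_zero.mpr (by exact_mod_cast h)) Real.pi_ne_zero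
      simp only [← mul_assoc]
      rw [intervalIntegral.integral_comp_mul_left _ hjk, integral_cos,
        show ((j : ℝ) - k) * Real.pi * (p + 2) = ((j : ℝ) - k) * Real.pi * p +
          (((j : ℤ) - k : ℤ) : ℝ) * (2 * Real.pi) by push_cast; ring,
        Real.sin_add_int_mul_two_pi, sub_self, smul_zero]
  rw [funext (fejer_eq_sum L), intervalIntegral.integral_const_mul,
    intervalIntegral.integral_finsetSum fun j _ =>
      Continuous.intervalIntegrable (by fun_prop) _ _]
  have hsum : ∀ j ∈ Finset.range L, (∫ x in p..p + 2, ∑ k ∈ Finset.range L,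
      Real.cos (((j : ℝ) - k) * (Real.pi * x))) = 2 := fun j hj => by
    rw [intervalIntegral.integral_finsetSum fun k _ =>
      Continuous.intervalIntegrable (by fun_prop) _ _]
    simp_rw [hcos]
    rw [Finset.sum_ite_eq, if_pos hj]
  rw [Finset.sum_congr rfl hsum]
  have : (L : ℝ) ≠ 0 := by exact_mod_cast hL
  simp; field_simp

lemma integral_fejer_cos_mul_sin {L : ℕ} (hL : L ≠ 0) (φ : ℝ) :
    ∫ t in 0..Real.pi, fejer L (Real.cos t - Real.cos φ) * Real.sin t = 2 := by
  have h := intervalIntegral.integral_comp_mul_deriv (a := 0) (b := Real.pi)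
    (f := fun t => Real.cos t - Real.cos φ) (f' := fun t => -Real.sin t) (g := fejer L)
    (fun t _ => (Real.hasDerivAt_cos t).sub_const _) (by fun_prop) (continuous_fejer L)
  simp only [Function.comp_def, mul_neg, intervalIntegral.integral_neg, Real.cos_zero,
    Real.cos_pi] at h
  rw [intervalIntegral.integral_symm (-1 - Real.cos φ), neg_inj] at h
  rw [h, ← integral_fejer hL (-1 - Real.cos φ)]
  congr 1; ring

/-- A continuous function on `[0, π]` vanishing at `φ` is dominated by a small multiple of `sin`
plus a multiple of a weight vanishing only at `φ`. -/
lemma exists_abs_le_sin_add {φ : ℝ} (hφ : φ ∈ Set.Ioo 0 Real.pi) {D : ℝ → ℝ} (hD : Continuous D)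
    (hDφ : D φ = 0) {ε : ℝ} (hε : 0 < ε) :
    ∃ M : ℝ, 0 ≤ M ∧ ∀ t ∈ Set.Icc 0 Real.pi, |D t| ≤ ε * Real.sin t +
      M * Real.sin (Real.pi * (Real.cos t - Real.cos φ) / 2) ^ 2 := by
  have hc : |Real.cos φ| < 1 := by
    have h := Real.sin_pos_of_mem_Ioo hφ
    rw [← sq_lt_one_iff_abs_lt_one]
    nlinarith [Real.sin_sq_add_cos_sq φ]
  rw [abs_lt] at hc
  set U : Set ℝ := {t | |D t| < ε * Real.sin t}
  have hU : IsOpen U := isOpen_lt (by fun_prop) (by fun_prop)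
  have hφU : φ ∈ U := by
    simpa [U, hDφ] using mul_pos hε (Real.sin_pos_of_mem_Ioo hφ)
  have hne : ∀ t ∈ Set.Icc 0 Real.pi \ U,
      Real.sin (Real.pi * (Real.cos t - Real.cos φ) / 2) ^ 2 ≠ 0 := by
    rintro t ⟨ht, htU⟩ h
    obtain ⟨k, hk⟩ := (sin_pi_mul_div_two_eq_zero_iff _).mp (pow_eq_zero_iff two_ne_zero |>.mp h)
    have h1 := Real.cos_le_one t
    have h2 := Real.neg_one_le_cos t
    have hk1 : (k : ℝ) < 1 := by linarith
    have hk2 : (-1 : ℝ) < k := by linarith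
    have hk0 : k = 0 := by
      have : k < 1 := by exact_mod_cast hk1
      have : -1 < k := by exact_mod_cast hk2
      omega
    rw [hk0, Int.cast_zero, mul_zero, sub_eq_zero] at hk
    exact htU (Real.injOn_cos ht (Set.Ioo_subset_Icc_self hφ) hk ▸ hφU)
  obtain ⟨M, hM⟩ := (isCompact_Icc.diff hU).exists_bound_of_continuousOn
    (f := fun t => D t / Real.sin (Real.pi * (Real.cos t - Real.cos φ) / 2) ^ 2)
    (ContinuousOn.div (by fun_prop) (by fun_prop) hne)
  refine ⟨max M 0, le_max_right _ _, fun t ht => ?_⟩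
  by_cases htU : t ∈ U
  · exact (le_of_lt htU).trans (le_add_of_nonneg_right (by positivity))
  · have h1 := hM t ⟨ht, htU⟩
    have hw := hne t ⟨ht, htU⟩
    have hpos := lt_of_le_of_ne (sq_nonneg _) hw.symm
    rw [norm_div, Real.norm_eq_abs, Real.norm_eq_abs, abs_of_pos hpos, div_le_iff₀ hpos] at h1
    have h3 : M * Real.sin (Real.pi * (Real.cos t - Real.cos φ) / 2) ^ 2 ≤
        max M 0 * Real.sin (Real.pi * (Real.cos t - Real.cos φ) / 2) ^ 2 :=
      mul_le_mul_of_nonneg_right (le_max_left _ _) hpos.le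
    have h4 : 0 ≤ ε * Real.sin t := mul_nonneg hε.le (Real.sin_nonneg_of_mem_Icc ht)
    linarith

lemma tendsto_integral_fejer_cos_mul_of_eq_zero {φ : ℝ} (hφ : φ ∈ Set.Ioo 0 Real.pi) {D : ℝ → ℝ}
    (hD : Continuous D) (hDφ : D φ = 0) :
    Tendsto (fun L : ℕ => ∫ t in 0..Real.pi, fejer L (Real.cos t - Real.cos φ) * D t)
      atTop (nhds 0) := by
  rw [Metric.tendsto_atTop']
  intro ε hε
  obtain ⟨M, hM0, hM⟩ := exists_abs_le_sin_add hφ hD hDφ (show 0 < ε / 4 by positivity)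
  have hlim : Tendsto (fun L : ℕ => Real.pi * M * (1 / (L : ℝ))) atTop (nhds 0) := by
    simpa using tendsto_one_div_atTop_nhds_zero_nat.const_mul (Real.pi * M)
  obtain ⟨N, hN⟩ := eventually_atTop.mp (hlim.eventually_lt_const (show 0 < ε / 2 by positivity))
  refine ⟨N, fun L hL => ?_⟩
  have hF := continuous_fejer L
  rw [dist_zero_right]
  calc ‖∫ t in 0..Real.pi, fejer L (Real.cos t - Real.cos φ) * D t‖
      ≤ ∫ t in 0..Real.pi,
          (ε / 4 * (fejer L (Real.cos t - Real.cos φ) * Real.sin t) + M * (1 / L)) := by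
        refine intervalIntegral.norm_integral_le_of_norm_le Real.pi_nonneg
          (ae_of_all _ fun t ht => ?_) (Continuous.intervalIntegrable (by fun_prop) _ _)
        have h0 := fejer_nonneg L (Real.cos t - Real.cos φ)
        rw [norm_mul, Real.norm_of_nonneg h0, Real.norm_eq_abs]
        have h1 := mul_le_mul_of_nonneg_left (hM t (Set.Ioc_subset_Icc_self ht)) h0
        have h2 := mul_le_mul_of_nonneg_left
          (fejer_mul_sin_sq_le L (Real.cos t - Real.cos φ)) hM0
        linarith
    _ = ε / 4 * 2 + Real.pi * M * (1 / L) := by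
        rw [intervalIntegral.integral_add (Continuous.intervalIntegrable (by fun_prop) _ _)
          (by simp), intervalIntegral.integral_const_mul,
          integral_fejer_cos_mul_sin (by omega) φ]
        simp; ring
    _ < ε := by linarith [hN L hL.le]

/-- The Fejér kernel composed with `cos · - cos φ` concentrates at `φ` with mass `2 / sin φ`. -/
lemma tendsto_integral_fejer_cos_mul {φ : ℝ} (hφ : φ ∈ Set.Ioo 0 Real.pi) {G : ℝ → ℝ}
    (hG : Continuous G) :
    Tendsto (fun L : ℕ => ∫ t in 0..Real.pi, fejer L (Real.cos t - Real.cos φ) * G t)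
      atTop (nhds (2 * G φ / Real.sin φ)) := by
  have hs := (Real.sin_pos_of_mem_Ioo hφ).ne'
  have h := (tendsto_integral_fejer_cos_mul_of_eq_zero hφ
    (D := fun t => G t - G φ / Real.sin φ * Real.sin t) (by fun_prop)
    (by field_simp; ring)).add_const (2 * G φ / Real.sin φ)
  rw [zero_add] at h
  refine h.congr' ?_
  filter_upwards [eventually_ne_atTop 0] with L hL
  have hF := continuous_fejer L
  have hsplit : ∀ t, fejer L (Real.cos t - Real.cos φ) *
      (G t - G φ / Real.sin φ * Real.sin t) = fejer L (Real.cos t - Real.cos φ) * G t -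
      G φ / Real.sin φ * (fejer L (Real.cos t - Real.cos φ) * Real.sin t) := fun t => by ring
  simp_rw [hsplit]
  rw [intervalIntegral.integral_sub (Continuous.intervalIntegrable (by fun_prop) _ _)
    (Continuous.intervalIntegrable (by fun_prop) _ _), intervalIntegral.integral_const_mul,
    integral_fejer_cos_mul_sin hL]
  ring

/-- Folding an integral over the line onto a half period. -/
lemma hasSum_integral_fold {f : ℝ → ℝ} (hf : Integrable f) (hfc : Continuous f) :
    HasSum (fun n : ℤ => ∫ t in 0..Real.pi,
      (f (t + 2 * Real.pi * n) + f (2 * Real.pi * (n + 1) - t))) (∫ t, f t) := by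
  have h := hasSum_integral_iUnion (μ := volume) (f := f)
    (s := fun n : ℤ => Set.Ioc (n • (2 * Real.pi)) ((n + 1) • (2 * Real.pi)))
    (fun n => measurableSet_Ioc) (Set.pairwise_disjoint_Ioc_zsmul _) hf.integrableOn
  rw [iUnion_Ioc_zsmul Real.two_pi_pos, setIntegral_univ] at h
  refine (congrArg (HasSum · _ _) (funext fun n => ?_)).mpr h
  have hi : ∀ a b : ℝ, IntervalIntegrable f volume a b := fun a b => hfc.intervalIntegrable a b
  simp only [zsmul_eq_mul, Int.cast_add, Int.cast_one]
  rw [← intervalIntegral.integral_of_le (by nlinarith [Real.pi_pos]),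
    ← intervalIntegral.integral_add_adjacent_intervals (hi _ (n * (2 * Real.pi) + Real.pi))
      (hi _ _),
    intervalIntegral.integral_add (Continuous.intervalIntegrable (by fun_prop) _ _)
      (Continuous.intervalIntegrable (by fun_prop) _ _),
    intervalIntegral.integral_comp_add_right f, intervalIntegral.integral_comp_sub_left f]
  congr 2 <;> ring

lemma gaussianPDFReal_add_two_pi_le {v : NNReal} (hv : v ≠ 0) (n : ℤ) {d : ℝ}
    (hd : |d| ≤ 2 * Real.pi) :
    gaussianPDFReal 0 v (d + 2 * Real.pi * n) ≤ (Real.sqrt (2 * Real.pi * v))⁻¹ *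
      Real.exp (-Real.pi * (2 * Real.pi / v * n ^ 2 - 2 * (2 * Real.pi / v) * |(n : ℝ)|)) := by
  have hv' : (0 : ℝ) < v := by positivity
  have hdn : -(d * n) ≤ 2 * Real.pi * |(n : ℝ)| :=
    (neg_le_abs _).trans ((abs_mul d n).trans_le
      (mul_le_mul_of_nonneg_right hd (abs_nonneg _)))
  rw [gaussianPDFReal]
  refine mul_le_mul_of_nonneg_left (Real.exp_le_exp.mpr ?_) (by positivity)
  rw [div_le_iff₀ (by positivity)]
  have h : -Real.pi * (2 * Real.pi / v * n ^ 2 - 2 * (2 * Real.pi / v) * |(n : ℝ)|) * (2 * v) =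
      -(4 * Real.pi ^ 2 * n ^ 2) + 4 * Real.pi * (2 * Real.pi * |(n : ℝ)|) := by
    field_simp; ring
  rw [h]
  nlinarith [sq_nonneg d, mul_le_mul_of_nonneg_left hdn (by positivity : 0 ≤ 4 * Real.pi)]

/-- The expectation as a sum over periods of integrals over a half period. -/
lemma hasSum_integral_fejer_gaussianReal (L : ℕ) (φ : ℝ) {v : NNReal} (hv : v ≠ 0) :
    HasSum (fun n : ℤ => ∫ t in 0..Real.pi, fejer L (Real.cos t - Real.cos φ) *
        (gaussianPDFReal 0 v (t - φ + 2 * Real.pi * n) +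
          gaussianPDFReal 0 v (2 * Real.pi - t - φ + 2 * Real.pi * n)))
      (∫ ω, fejer L (Real.cos (φ + ω) - Real.cos φ) ∂(gaussianReal 0 v)) := by
  have hF := continuous_fejer L
  have hg : Continuous (gaussianPDFReal 0 v) := by
    rw [gaussianPDFReal_def]; fun_prop
  have hint : Integrable fun t =>
      fejer L (Real.cos t - Real.cos φ) * gaussianPDFReal 0 v (t - φ) := by
    refine ((integrable_gaussianPDFReal 0 v).comp_sub_right φ).bdd_mul (c := L)
      (by fun_prop) (ae_of_all _ fun t => ?_)
    rw [Real.norm_of_nonneg (fejer_nonneg _ _)]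
    exact fejer_le _ _
  have h := hasSum_integral_fold hint (by fun_prop)
  rw [integral_gaussianReal_eq_integral_smul hv,
    ← integral_sub_right_eq_self (fun ω => gaussianPDFReal 0 v ω •
      fejer L (Real.cos (φ + ω) - Real.cos φ)) φ]
  simp only [smul_eq_mul, add_sub_cancel, mul_comm (gaussianPDFReal _ _ _)]
  refine (congrArg (HasSum · _ _) (funext fun n => ?_)).mpr h
  refine intervalIntegral.integral_congr fun t _ => ?_
  have h1 : Real.cos (t + 2 * Real.pi * n) = Real.cos t := by
    rw [mul_comm, Real.cos_add_int_mul_two_pi]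
  have h2 : Real.cos (2 * Real.pi * (n + 1) - t) = Real.cos t := by
    rw [← Real.cos_int_mul_two_pi_sub t (n + 1)]
    congr 1; push_cast; ring
  simp only [h1, h2, ← mul_add]
  congr 3 <;> ring

/-- Key computation behind Proposition 2: for `ω ~ N(0, σ²)`,
`lim_{L→∞} E[F_L(cos(φ + ω) − cos φ)] = 2·h(φ, σ²)`. -/
theorem stmt12 (φ σ : ℝ) (hφ : φ ∈ Set.Ioo 0 Real.pi) (hσ : 0 < σ) :
    Tendsto (fun L : ℕ =>
        ∫ ω, fejer L (Real.cos (φ + ω) - Real.cos φ)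
          ∂(gaussianReal 0 ⟨σ ^ 2, sq_nonneg σ⟩))
      atTop (nhds (2 * hfun φ (σ ^ 2))) := by
  set v : NNReal := ⟨σ ^ 2, sq_nonneg σ⟩
  have hvσ : (v : ℝ) = σ ^ 2 := rfl
  have hv : v ≠ 0 := by
    rw [← NNReal.coe_ne_zero, hvσ]; positivity
  have hsin := Real.sin_pos_of_mem_Ioo hφ
  have hg : Continuous (gaussianPDFReal 0 v) := by
    rw [gaussianPDFReal_def]; fun_prop
  have hlim : 2 * hfun φ (σ ^ 2) = ∑' n : ℤ, 2 * (gaussianPDFReal 0 v (φ - φ + 2 * Real.pi * n) +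
      gaussianPDFReal 0 v (2 * Real.pi - φ - φ + 2 * Real.pi * n)) / Real.sin φ := by
    rw [hfun, ← tsum_mul_left, ← tsum_mul_left]
    refine tsum_congr fun n => ?_
    rw [gaussianPDFReal, gaussianPDFReal, hvσ, Real.sqrt_mul (by positivity),
      Real.sqrt_sq hsin.le, ← mul_add]
    have e1 : -(φ - φ + 2 * Real.pi * n - 0) ^ 2 / (2 * σ ^ 2) =
        -2 * (n * Real.pi) ^ 2 / σ ^ 2 := by field_simp; ring
    have e2 : -(2 * Real.pi - φ - φ + 2 * Real.pi * n - 0) ^ 2 / (2 * σ ^ 2) =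
        -2 * ((n + 1) * Real.pi - φ) ^ 2 / σ ^ 2 := by field_simp; ring
    rw [e1, e2]
    field_simp
  obtain ⟨C, hC⟩ := (tendsto_integral_fejer_cos_mul hφ
    (continuous_const (y := (1 : ℝ)))).isBoundedUnder_le
  rw [eventually_map] at hC
  simp_rw [← fun L => (hasSum_integral_fejer_gaussianReal L φ hv).tsum_eq]
  rw [hlim]
  set b : ℤ → ℝ := fun n => (Real.sqrt (2 * Real.pi * v))⁻¹ *
    Real.exp (-Real.pi * (2 * Real.pi / v * n ^ 2 - 2 * (2 * Real.pi / v) * |(n : ℝ)|))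
  have hb : Summable b := by
    have h := summable_pow_mul_jacobiTheta₂_term_bound (2 * Real.pi / v)
      (T := 2 * Real.pi / v) (by positivity) 0
    simp only [pow_zero, one_mul] at h
    simpa only [b, Int.cast_abs] using h.mul_left _
  refine tendsto_tsum_of_dominated_convergence (bound := fun n => C * (2 * b n))
    ((hb.mul_left 2).mul_left C) (fun n => tendsto_integral_fejer_cos_mul hφ
      (G := fun t => gaussianPDFReal 0 v (t - φ + 2 * Real.pi * n) +
        gaussianPDFReal 0 v (2 * Real.pi - t - φ + 2 * Real.pi * n)) (by fun_prop)) ?_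
  filter_upwards [hC] with L hCL n
  have hF := continuous_fejer L
  have hb0 : 0 ≤ b n := by positivity
  calc ‖∫ t in 0..Real.pi, fejer L (Real.cos t - Real.cos φ) *
        (gaussianPDFReal 0 v (t - φ + 2 * Real.pi * n) +
          gaussianPDFReal 0 v (2 * Real.pi - t - φ + 2 * Real.pi * n))‖
      ≤ ∫ t in 0..Real.pi, fejer L (Real.cos t - Real.cos φ) * 1 * (2 * b n) := by
        refine intervalIntegral.norm_integral_le_of_norm_le Real.pi_nonneg
          (ae_of_all _ fun t ht => ?_) (Continuous.intervalIntegrable (by fun_prop) _ _)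
        have h0 := fejer_nonneg L (Real.cos t - Real.cos φ)
        have hd1 : |t - φ| ≤ 2 * Real.pi :=
          abs_le.mpr ⟨by linarith [ht.1, ht.2, hφ.1, hφ.2], by linarith [ht.1, ht.2, hφ.1, hφ.2]⟩
        have hd2 : |2 * Real.pi - t - φ| ≤ 2 * Real.pi :=
          abs_le.mpr ⟨by linarith [ht.1, ht.2, hφ.1, hφ.2], by linarith [ht.1, ht.2, hφ.1, hφ.2]⟩
        rw [Real.norm_of_nonneg (mul_nonneg h0
          (add_nonneg (gaussianPDFReal_nonneg _ _ _) (gaussianPDFReal_nonneg _ _ _))), mul_one]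
        refine mul_le_mul_of_nonneg_left ?_ h0
        rw [two_mul (b n)]
        exact add_le_add (gaussianPDFReal_add_two_pi_le hv n hd1)
          (gaussianPDFReal_add_two_pi_le hv n hd2)
    _ ≤ C * (2 * b n) := by
        rw [intervalIntegral.integral_mul_const]
        exact mul_le_mul_of_nonneg_right hCL (by positivity)
end

section
/- Let K ≥ 2, M > 0, and let F be a symmetric K×K real matrix with nonnegative entries such that c := min_{1≤k≤K} ∑_{j ≠ k} F_{k j} > 0. Then for every vector p ∈ ℝ^K with p_k ≥ 0 for all k, ∑_k p_k > 0, and ∑_{j ≠ k} p_j F_{k j} > 0 for all k, one has min_{1≤k≤K} ( p_k · M / ∑_{j ≠ k} p_j F_{k j} ) ≤ M / c. Consequently, the max–min signal-to-interference-ratio rate satisfies min_k log₂(1 + p_k M / ∑_{j≠k} p_j F_{k j}) ≤ log₂(1 + M/c) for every such p. -/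
open Finset

theorem sum_sum_erase_mul_eq_of_symm {ι R : Type*} [Fintype ι] [DecidableEq ι]
    [NonUnitalNonAssocSemiring R] {F : ι → ι → R} (hsym : ∀ k j, F k j = F j k) (p : ι → R) :
    ∑ k, ∑ j ∈ Finset.univ.erase k, p j * F k j =
      ∑ j, p j * ∑ k ∈ Finset.univ.erase j, F j k := by
  simp_rw [Finset.mul_sum]
  rw [Finset.sum_comm' (t' := Finset.univ) (s' := fun j => Finset.univ.erase j)
    (by simp [ne_comm])]
  simp_rw [hsym]

/-- Some index has a power-to-interference ratio at most `M / c`, for any lower bound `c` on the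
off-diagonal row sums of a symmetric matrix. -/
theorem exists_mul_div_sum_erase_le {ι : Type*} [Fintype ι] [DecidableEq ι] [Nonempty ι]
    {M c : ℝ} (hM : 0 < M) (hc : 0 < c) {F : ι → ι → ℝ} (hsym : ∀ k j, F k j = F j k)
    (hrow : ∀ k, c ≤ ∑ j ∈ Finset.univ.erase k, F k j) {p : ι → ℝ} (hp : ∀ k, 0 ≤ p k)
    (hint : ∀ k, 0 < ∑ j ∈ Finset.univ.erase k, p j * F k j) :
    ∃ k, p k * M / ∑ j ∈ Finset.univ.erase k, p j * F k j ≤ M / c := by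
  have hle : ∑ k, p k * c ≤ ∑ k, ∑ j ∈ Finset.univ.erase k, p j * F k j := by
    rw [sum_sum_erase_mul_eq_of_symm hsym]
    gcongr with k
    · exact hp k
    · exact hrow k
  obtain ⟨k, -, hk⟩ := Finset.exists_le_of_sum_le Finset.univ_nonempty hle
  refine ⟨k, ?_⟩
  rw [div_le_div_iff₀ (hint k) hc]
  nlinarith [mul_le_mul_of_nonneg_left hk hM.le]

/-- Proposition 4 (interference-limited upper bound): for a symmetric nonnegative
interference matrix `F` with `c = min_k ∑_{j≠k} F_{kj} > 0`, every feasible power vector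
`p` satisfies `min_k (p_k·M / ∑_{j≠k} p_j·F_{kj}) ≤ M/c`, and hence the max–min SIR rate
is at most `log₂(1 + M/c)`. -/
theorem stmt17 (K : ℕ) (hK : 2 ≤ K) (M : ℝ) (hM : 0 < M)
    (F : Fin K → Fin K → ℝ) (hsym : ∀ k j, F k j = F j k) (hnn : ∀ k j, 0 ≤ F k j)
    (c : ℝ) (hc : 0 < c)
    (hmin : IsLeast {x : ℝ | ∃ k : Fin K, x = ∑ j ∈ Finset.univ.erase k, F k j} c)
    (p : Fin K → ℝ) (hp : ∀ k, 0 ≤ p k) (hsum : 0 < ∑ k, p k)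
    (hint : ∀ k, 0 < ∑ j ∈ Finset.univ.erase k, p j * F k j) :
    (Finset.univ.inf'
        (Finset.univ_nonempty_iff.mpr (Fin.pos_iff_nonempty.mp (by omega)))
        (fun k => p k * M / ∑ j ∈ Finset.univ.erase k, p j * F k j) ≤ M / c) ∧
    Finset.univ.inf'
        (Finset.univ_nonempty_iff.mpr (Fin.pos_iff_nonempty.mp (by omega)))
        (fun k => Real.logb 2 (1 + p k * M / ∑ j ∈ Finset.univ.erase k, p j * F k j))
      ≤ Real.logb 2 (1 + M / c) := by
  have : Nonempty (Fin K) := Fin.pos_iff_nonempty.mp (by omega)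
  obtain ⟨k, hk⟩ :=
    exists_mul_div_sum_erase_le hM hc hsym (fun k => hmin.2 ⟨k, rfl⟩) hp hint
  refine ⟨(Finset.inf'_le _ (Finset.mem_univ k)).trans hk,
    (Finset.inf'_le _ (Finset.mem_univ k)).trans ?_⟩
  have hratio : 0 ≤ p k * M / ∑ j ∈ Finset.univ.erase k, p j * F k j :=
    div_nonneg (mul_nonneg (hp k) hM.le) (hint k).le
  exact Real.logb_le_logb_of_le one_lt_two (by linarith) (by linarith)
end
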